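/- For every integer n ≥ 1, the number of words of length n belonging to L(Ω) is exactly (d−1)n + 1. -/

import Mathlib

/-- The substitution σ on the alphabet A = {1, …, d}:
σ(1) = 12, σ(k) = k+1 for 2 ≤ k ≤ d−1, σ(d) = 1. Letters are literal natural numbers. -/
def sig (d : ℕ) (a : ℕ) : List ℕ :=
  if a = 1 then [1, 2] else if a = d then [1] else [a + 1]

/-- Extension of a substitution to finite words by concatenation. -/
def applySub (f : ℕ → List ℕ) : List ℕ → List ℕ
  | [] => []
  | a :: w => f a ++ applySub f w

/-- σⁿ applied to a word. -/
def sigIter (d n : ℕ) (w : List ℕ) : List ℕ := (applySub (sig d))^[n] w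

/-- The language L(Ω): the set of finite factors of the fixed point ω, i.e. of the
words σⁿ(1). -/
def Lang (d : ℕ) (u : List ℕ) : Prop := ∃ n : ℕ, u <:+: sigIter d n [1]

/-- `w` is a (finite) prefix of the infinite word `V`. -/
def PrefixOfInf (w : List ℕ) (V : ℕ → ℕ) : Prop :=
  ∀ (i : ℕ) (h : i < w.length), w.get ⟨i, h⟩ = V i

/-- `ω` is the fixed point of σ: the unique infinite word admitting every σⁿ(1) as a
prefix. -/
def IsSigmaFixedPoint (d : ℕ) (ω : ℕ → ℕ) : Prop :=
  ∀ n : ℕ, PrefixOfInf (sigIter d n [1]) ω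

/-- `u` is left-special: there are distinct letters a, b ∈ A with au, bu ∈ L(Ω). -/
def LeftSpecial (d : ℕ) (u : List ℕ) : Prop :=
  ∃ a b : ℕ, a ≠ b ∧ 1 ≤ a ∧ a ≤ d ∧ 1 ≤ b ∧ b ≤ d ∧
    Lang d (a :: u) ∧ Lang d (b :: u)

/-- `u` is right-special: there are distinct letters a, b ∈ A with ua, ub ∈ L(Ω). -/
def RightSpecial (d : ℕ) (u : List ℕ) : Prop :=
  ∃ a b : ℕ, a ≠ b ∧ 1 ≤ a ∧ a ≤ d ∧ 1 ≤ b ∧ b ≤ d ∧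
    Lang d (u ++ [a]) ∧ Lang d (u ++ [b])

/-- `u` is bispecial: both left- and right-special. -/
def Bispecial (d : ℕ) (u : List ℕ) : Prop := LeftSpecial d u ∧ RightSpecial d u

/-- The shift S on infinite words. -/
def shiftMap (V : ℕ → ℕ) : ℕ → ℕ := fun i => V (i + 1)

/-- Ω⁺ : the closure (for the product topology, letters discrete) of the shift
orbit of ω. -/
def OmegaPlus (ω : ℕ → ℕ) : Set (ℕ → ℕ) :=
  closure {V : ℕ → ℕ | ∃ n : ℕ, V = shiftMap^[n] ω}

/-- The cylinder C_u = {V ∈ Ω⁺ : u is a prefix of V}. -/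
def Cyl (ω : ℕ → ℕ) (u : List ℕ) : Set (ℕ → ℕ) :=
  {V | V ∈ OmegaPlus ω ∧ PrefixOfInf u V}

/-- Prepending a letter to an infinite word. -/
def consInf (a : ℕ) (V : ℕ → ℕ) : ℕ → ℕ :=
  fun i => match i with
  | 0 => a
  | j + 1 => V j

/-- Extension of σ to infinite words: σ(V) = σ(V₀)σ(V₁)σ(V₂)⋯ (each σ(a) is a
nonempty word, so the n-th letter of σ(V) is the n-th letter of σ(V₀…Vₙ)). -/
def sigInf (d : ℕ) (V : ℕ → ℕ) : ℕ → ℕ :=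
  fun n => (applySub (sig d) ((List.range (n + 1)).map V)).getD n 0

/-- Concatenation of a finite list of words. -/
def concatAll : List (List ℕ) → List ℕ
  | [] => []
  | w :: ws => w ++ concatAll ws

theorem applySub_append (f : ℕ → List ℕ) (u v : List ℕ) :
    applySub f (u ++ v) = applySub f u ++ applySub f v := by
  induction u with
  | nil => rfl
  | cons a u ih => simp [applySub, ih]

theorem applySub_prefix (f : ℕ → List ℕ) {u v : List ℕ} (h : u <+: v) :
    applySub f u <+: applySub f v := by
  obtain ⟨t, rfl⟩ := h
  exact ⟨applySub f t, (applySub_append f u t).symm⟩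

theorem applySub_infix (f : ℕ → List ℕ) {u v : List ℕ} (h : u <:+: v) :
    applySub f u <:+: applySub f v := by
  obtain ⟨s, t, rfl⟩ := h
  exact ⟨applySub f s, applySub f t, by simp [applySub_append]⟩

theorem sig_one (d : ℕ) : sig d 1 = [1, 2] := by simp [sig]

/-- The last letter of `sig d a`. -/
def lastLetter (d a : ℕ) : ℕ := if a = d then 1 else a + 1

theorem sig_of_ne_one {d a : ℕ} (h : a ≠ 1) : sig d a = [lastLetter d a] := by
  simp only [sig, lastLetter, if_neg h]
  split <;> rfl

theorem sigIter_succ (d n : ℕ) (w : List ℕ) :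
    sigIter d (n + 1) w = applySub (sig d) (sigIter d n w) :=
  Function.iterate_succ_apply' _ _ _

theorem sigIter_append (d n : ℕ) (u v : List ℕ) :
    sigIter d n (u ++ v) = sigIter d n u ++ sigIter d n v := by
  induction n with
  | zero => rfl
  | succ n ih => simp [sigIter_succ, ih, applySub_append]

theorem sigIter_succ_one (d n : ℕ) :
    sigIter d (n + 1) [1] = sigIter d n [1] ++ sigIter d n [2] := by
  rw [← sigIter_append]
  simp [sigIter, Function.iterate_succ_apply, applySub, sig_one]

theorem sig_ne_nil (d a : ℕ) : sig d a ≠ [] := by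
  unfold sig
  split_ifs <;> simp

theorem sigIter_ne_nil (d n : ℕ) {w : List ℕ} (hw : w ≠ []) : sigIter d n w ≠ [] := by
  induction n with
  | zero => exact hw
  | succ n ih =>
    rw [sigIter_succ]
    obtain ⟨a, v, h⟩ := List.exists_cons_of_ne_nil ih
    simp [h, applySub, sig_ne_nil]

theorem lt_length_sigIter_one (d n : ℕ) : n < (sigIter d n [1]).length := by
  induction n with
  | zero => simp [sigIter]
  | succ n ih =>
    have := List.length_pos_iff.2 (sigIter_ne_nil d n (w := [2]) (by simp))
    rw [sigIter_succ_one, List.length_append]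
    omega

theorem sigIter_one_prefix (d : ℕ) {m n : ℕ} (h : m ≤ n) :
    sigIter d m [1] <+: sigIter d n [1] := by
  induction n, h using Nat.le_induction with
  | base => exact List.prefix_rfl
  | succ n _ ih =>
    rw [sigIter_succ_one]
    exact ih.trans (List.prefix_append _ _)

theorem Lang.of_infix {d : ℕ} {u v : List ℕ} (hv : Lang d v) (h : u <:+: v) : Lang d u :=
  hv.imp fun _ hn => h.trans hn

theorem Lang.applySub_sig {d : ℕ} {u : List ℕ} (hu : Lang d u) : Lang d (applySub (sig d) u) := by
  obtain ⟨n, hn⟩ := hu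
  exact ⟨n + 1, by rw [sigIter_succ]; exact applySub_infix _ hn⟩

/-- Every letter is in the alphabet, and each letter is followed by its successor or by `1`. -/
def Admissible (d : ℕ) (w : List ℕ) : Prop :=
  (∀ a ∈ w, 1 ≤ a ∧ a ≤ d) ∧ w.IsChain fun a b => b = 1 ∨ b = a + 1

theorem Admissible.applySub_sig {d : ℕ} (hd : 3 ≤ d) {w : List ℕ} (hw : Admissible d w) :
    Admissible d (applySub (sig d) w) := by
  induction w with
  | nil => simpa [applySub] using hw
  | cons x w ih =>
    obtain ⟨hl, hc⟩ := hw
    have hx := hl x (by simp)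
    obtain ⟨hl', hc'⟩ := ih ⟨fun a ha => hl a (by simp [ha]), hc.tail⟩
    have hlast : 1 ≤ lastLetter d x ∧ lastLetter d x ≤ d := by
      unfold lastLetter; split_ifs <;> omega
    have key : (lastLetter d x :: applySub (sig d) w).IsChain
        fun a b => b = 1 ∨ b = a + 1 := by
      cases w with
      | nil => simp [applySub]
      | cons y w =>
        have hy := hl y (by simp)
        have hxy := (List.isChain_cons_cons.1 hc).1
        by_cases h1 : y = 1
        · subst h1
          simp only [applySub, sig_one, List.cons_append] at hc' ⊢
          exact List.isChain_cons_cons.2 ⟨Or.inl rfl, hc'⟩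
        · simp only [applySub, sig_of_ne_one h1, List.cons_append] at hc' ⊢
          refine List.isChain_cons_cons.2 ⟨?_, hc'⟩
          unfold lastLetter
          split_ifs <;> omega
    by_cases h1 : x = 1
    · subst h1
      have h2 : lastLetter d 1 = 2 := by unfold lastLetter; split_ifs <;> omega
      rw [h2] at key
      simp only [applySub, sig_one]
      refine ⟨?_, List.isChain_cons_cons.2 ⟨Or.inr rfl, key⟩⟩
      intro a ha
      simp only [List.cons_append, List.nil_append, List.mem_cons] at ha
      rcases ha with rfl | rfl | ha
      · omega
      · omega
      · exact hl' a ha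
    · simp only [applySub, sig_of_ne_one h1]
      refine ⟨?_, key⟩
      intro a ha
      simp only [List.cons_append, List.nil_append, List.mem_cons] at ha
      rcases ha with rfl | ha
      · exact hlast
      · exact hl' a ha

theorem Lang.admissible {d : ℕ} (hd : 3 ≤ d) {u : List ℕ} (hu : Lang d u) : Admissible d u := by
  obtain ⟨n, hn⟩ := hu
  have key : Admissible d (sigIter d n [1]) := by
    induction n generalizing u with
    | zero => exact ⟨by simp [sigIter]; omega, by simp [sigIter]⟩
    | succ n ih =>
      rw [sigIter_succ]
      exact (ih List.infix_rfl).applySub_sig hd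
  exact ⟨fun a ha => key.1 a (hn.subset ha), key.2.infix hn⟩

theorem lang_pair_succ {d k : ℕ} (h1 : 1 ≤ k) (hk : k < d) : Lang d [k, k + 1] := by
  induction k, h1 using Nat.le_induction with
  | base => exact ⟨1, by simp [sigIter, applySub, sig_one]⟩
  | succ k h1 ih =>
    have h := (ih (by omega)).applySub_sig
    have hs : applySub (sig d) [k + 1] = [k + 1 + 1] := by
      simp [applySub, sig_of_ne_one (show k + 1 ≠ 1 by omega), lastLetter, hk.ne]
    by_cases hk1 : k = 1
    · subst hk1
      refine h.of_infix ⟨[1], [], ?_⟩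
      change _ = sig d 1 ++ applySub (sig d) [1 + 1]
      rw [hs, sig_one]; rfl
    · refine h.of_infix ⟨[], [], ?_⟩
      change _ = sig d k ++ applySub (sig d) [k + 1]
      rw [hs, sig_of_ne_one hk1, lastLetter, if_neg (by omega)]; rfl

theorem lang_one_one {d : ℕ} (hd : 3 ≤ d) : Lang d [1, 1] := by
  obtain ⟨e, rfl⟩ : ∃ e, d = e + 1 := ⟨d - 1, by omega⟩
  have h := (lang_pair_succ (d := e + 1) (k := e) (by omega) (by omega)).applySub_sig.applySub_sig
  have h2 : e ≠ 1 := by omega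
  have h3 : e ≠ 0 := by omega
  exact h.of_infix ⟨[], [2], by simp [applySub, sig, h2, h3]⟩

theorem lang_pair_one {d a : ℕ} (hd : 3 ≤ d) (h1 : 1 ≤ a) (ha : a ≤ d) : Lang d [a, 1] := by
  induction a, h1 using Nat.le_induction with
  | base => exact lang_one_one hd
  | succ k h1 ih =>
    have h := (ih (by omega)).applySub_sig
    by_cases hk1 : k = 1
    · subst hk1
      exact h.of_infix ⟨[1], [2], by simp [applySub, sig_one]⟩
    · exact h.of_infix ⟨[], [2], by
        simp [applySub, sig_one, sig_of_ne_one hk1, lastLetter, show k ≠ d by omega]⟩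

theorem lang_cons_sigIter_one {d : ℕ} (hd : 3 ≤ d) (n : ℕ) {a : ℕ} (h1 : 1 ≤ a) (ha : a ≤ d) :
    Lang d (a :: sigIter d n [1]) := by
  induction n generalizing a with
  | zero => exact lang_pair_one hd h1 ha
  | succ n ih =>
    rw [sigIter_succ]
    by_cases h : a = 1
    · subst h
      have := (ih (show 1 ≤ d by omega) le_rfl).applySub_sig
      simpa [applySub, sig, show d ≠ 1 by omega] using this
    · have := (ih (a := a - 1) (by omega) (by omega)).applySub_sig
      refine this.of_infix (List.IsSuffix.isInfix ?_)
      by_cases h2 : a = 2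
      · subst h2
        exact ⟨[1], by simp [applySub, sig_one]⟩
      · refine ⟨[], ?_⟩
        simp only [applySub, sig_of_ne_one (show a - 1 ≠ 1 by omega), lastLetter,
          if_neg (show a - 1 ≠ d by omega), show a - 1 + 1 = a by omega]
        rfl

theorem Lang.exists_cons {d : ℕ} (hd : 3 ≤ d) {u : List ℕ} (hu : Lang d u) :
    ∃ a, Lang d (a :: u) := by
  obtain ⟨n, s, t, h⟩ := hu
  have h1 := lang_cons_sigIter_one hd n le_rfl (show 1 ≤ d by omega)
  rcases List.eq_nil_or_concat (1 :: s) with h0 | ⟨r, a, hr⟩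
  · simp at h0
  · refine ⟨a, h1.of_infix ⟨r, t, ?_⟩⟩
    rw [← h, ← List.cons_append, ← List.cons_append, hr]
    simp

/-- A cut of a substituted word just before a letter `1` is a cut between images of letters. -/
theorem exists_cut_of_eq_applySub {d : ℕ} {W s t : List ℕ} {a : ℕ}
    (h : s ++ a :: 1 :: t = applySub (sig d) W) :
    ∃ p V, p :: V <:+ W ∧ (p = 1 ∧ a = 2 ∨ p ≠ 1 ∧ a = lastLetter d p) ∧
      1 :: t = applySub (sig d) V := by
  induction W generalizing s with
  | nil => simp [applySub] at h
  | cons x W ih =>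
    have lift {s' : List ℕ} (h' : s' ++ a :: 1 :: t = applySub (sig d) W) :
        ∃ p V, p :: V <:+ x :: W ∧ (p = 1 ∧ a = 2 ∨ p ≠ 1 ∧ a = lastLetter d p) ∧
          1 :: t = applySub (sig d) V := by
      obtain ⟨p, V, hs, hp⟩ := ih h'
      exact ⟨p, V, hs.trans (List.suffix_cons x W), hp⟩
    by_cases hx : x = 1
    · subst hx
      simp only [applySub, sig_one, List.cons_append, List.nil_append] at h
      match s, h with
      | [], h => simp at h
      | [_], h =>
        simp only [List.cons_append, List.nil_append, List.cons.injEq] at h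
        exact ⟨1, W, List.suffix_rfl, Or.inl ⟨rfl, h.2.1⟩, h.2.2⟩
      | _ :: _ :: s, h =>
        simp only [List.cons_append, List.cons.injEq] at h
        exact lift h.2.2
    · simp only [applySub, sig_of_ne_one hx, List.cons_append, List.nil_append] at h
      match s, h with
      | [], h =>
        simp only [List.nil_append, List.cons.injEq] at h
        exact ⟨x, W, List.suffix_rfl, Or.inr ⟨hx, h.1⟩, h.2⟩
      | _ :: s, h =>
        simp only [List.cons_append, List.cons.injEq] at h
        exact lift h.2

theorem Lang.exists_desubstitution {d a : ℕ} {u : List ℕ} (h : Lang d (a :: 1 :: u)) :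
    ∃ p V, Lang d (p :: V) ∧ (p = 1 ∧ a = 2 ∨ p ≠ 1 ∧ a = lastLetter d p) ∧
      1 :: u <+: applySub (sig d) V := by
  obtain ⟨n, hn⟩ := h
  obtain ⟨s, t, h⟩ := hn.trans (sigIter_one_prefix d n.le_succ).isInfix
  rw [sigIter_succ] at h
  obtain ⟨p, V, hs, hp, hV⟩ :=
    exists_cut_of_eq_applySub (s := s) (a := a) (t := u ++ t) (by rw [← h]; simp)
  exact ⟨p, V, ⟨n, hs.isInfix⟩, hp, t, hV⟩

theorem two_cons_ne_applySub {d : ℕ} {u W : List ℕ} (hW : ∀ a ∈ W, 1 ≤ a) :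
    ¬ 2 :: u <+: applySub (sig d) W := by
  cases W with
  | nil => simp [applySub]
  | cons x W =>
    have := hW x (by simp)
    by_cases hx : x = 1
    · subst hx
      simp [applySub, sig_one]
    · simp only [applySub, sig_of_ne_one hx, List.cons_append, List.cons_prefix_cons, lastLetter]
      split_ifs <;> omega

/-- A common prefix of two substituted words comes from a common prefix of the two words, up to
a last letter `1` that may begin the image of `1` or be the image of `d`. -/
theorem common_prefix_desubstitution {d : ℕ} {u W W' : List ℕ}
    (hW : ∀ a ∈ W, 1 ≤ a) (hW' : ∀ a ∈ W', 1 ≤ a)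
    (h : u <+: applySub (sig d) W) (h' : u <+: applySub (sig d) W') :
    ∃ v, v <+: W ∧ v <+: W' ∧ (u = applySub (sig d) v ∨
      u = applySub (sig d) v ++ [1] ∧ ∃ x y, (x = 1 ∨ x = d) ∧ (y = 1 ∨ y = d) ∧
        v ++ [x] <+: W ∧ v ++ [y] <+: W') := by
  induction W generalizing u W' with
  | nil => exact ⟨[], by simp, by simp, Or.inl (by simpa [applySub] using h)⟩
  | cons x W ih =>
    cases W' with
    | nil => exact ⟨[], by simp, by simp, Or.inl (by simpa [applySub] using h')⟩
    | cons y W' =>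
      have hx := hW x (by simp)
      have hy := hW' y (by simp)
      have hW1 : ∀ a ∈ W, 1 ≤ a := fun a ha => hW a (by simp [ha])
      have hW1' : ∀ a ∈ W', 1 ≤ a := fun a ha => hW' a (by simp [ha])
      have lift {u' : List ℕ} (hxy : x = y) (hu : u = sig d x ++ u')
          (g : u' <+: applySub (sig d) W) (g' : u' <+: applySub (sig d) W') :
          ∃ v, v <+: x :: W ∧ v <+: y :: W' ∧ (u = applySub (sig d) v ∨
            u = applySub (sig d) v ++ [1] ∧ ∃ x' y', (x' = 1 ∨ x' = d) ∧ (y' = 1 ∨ y' = d) ∧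
            v ++ [x'] <+: x :: W ∧ v ++ [y'] <+: y :: W') := by
        subst hxy
        obtain ⟨v, hv, hv', hc⟩ := ih hW1 hW1' g g'
        refine ⟨x :: v, by simpa using hv, by simpa using hv', ?_⟩
        rcases hc with hc | ⟨hc, z, z', hz, hz', g, g'⟩
        · exact Or.inl (by rw [hu, hc]; rfl)
        · refine Or.inr ⟨by rw [hu, hc]; simp [applySub], z, z', hz, hz', ?_, ?_⟩
          · simpa using g
          · simpa using g'
      have single (hu : u = [1]) (hx : x = 1 ∨ x = d) (hy : y = 1 ∨ y = d) :
          ∃ v, v <+: x :: W ∧ v <+: y :: W' ∧ (u = applySub (sig d) v ∨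
            u = applySub (sig d) v ++ [1] ∧ ∃ x' y', (x' = 1 ∨ x' = d) ∧ (y' = 1 ∨ y' = d) ∧
            v ++ [x'] <+: x :: W ∧ v ++ [y'] <+: y :: W') :=
        ⟨[], by simp, by simp, Or.inr ⟨hu, x, y, hx, hy, by simp, by simp⟩⟩
      match u, h, h' with
      | [], _, _ => exact ⟨[], by simp, by simp, Or.inl rfl⟩
      | c :: u, h, h' =>
        simp only [applySub] at h h'
        by_cases hx1 : x = 1 <;> by_cases hy1 : y = 1
        · subst hx1 hy1
          match u, h, h' with
          | [], h, h' =>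
            simp only [sig_one, List.cons_append, List.cons_prefix_cons] at h
            exact single (by rw [h.1]) (Or.inl rfl) (Or.inl rfl)
          | c' :: u, h, h' =>
            simp only [sig_one, List.cons_append, List.cons_prefix_cons, List.nil_append] at h h'
            exact lift rfl (by rw [h.1, h.2.1, sig_one]; rfl) h.2.2 h'.2.2
        · subst hx1
          simp only [sig_one, sig_of_ne_one hy1, List.cons_append, List.cons_prefix_cons,
            List.nil_append] at h h'
          have hyd : y = d := by
            by_contra hne
            have := h.1.symm.trans h'.1
            rw [lastLetter, if_neg hne] at this
            omega
          match u, h, h' with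
          | [], h, h' => exact single (by rw [h.1]) (Or.inl rfl) (Or.inr hyd)
          | c' :: u, h, h' =>
            rw [List.cons_prefix_cons] at h
            rw [h.2.1] at h'
            exact absurd h'.2 (two_cons_ne_applySub hW1')
        · subst hy1
          simp only [sig_one, sig_of_ne_one hx1, List.cons_append, List.cons_prefix_cons,
            List.nil_append] at h h'
          have hxd : x = d := by
            by_contra hne
            have := h'.1.symm.trans h.1
            rw [lastLetter, if_neg hne] at this
            omega
          match u, h, h' with
          | [], h, h' => exact single (by rw [h'.1]) (Or.inr hxd) (Or.inl rfl)
          | c' :: u, h, h' =>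
            rw [List.cons_prefix_cons] at h'
            rw [h'.2.1] at h
            exact absurd h.2 (two_cons_ne_applySub hW1)
        · simp only [sig_of_ne_one hx1, sig_of_ne_one hy1, List.cons_append,
            List.cons_prefix_cons, List.nil_append] at h h'
          have hxy : x = y := by
            have := h.1.symm.trans h'.1
            unfold lastLetter at this
            split_ifs at this <;> omega
          exact lift hxy (by rw [h.1, sig_of_ne_one hx1]; rfl) h.2 h'.2

theorem exists_append_prefix {d n : ℕ} {v : List ℕ} (h : v <+: sigIter d n [1]) :
    ∃ c m, v ++ [c] <+: sigIter d m [1] := by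
  have hlt := lt_length_sigIter_one d (n + v.length)
  obtain ⟨t, ht⟩ := h.trans (sigIter_one_prefix d (Nat.le_add_right n v.length))
  cases t with
  | nil =>
    rw [← ht, List.append_nil] at hlt
    omega
  | cons c t => exact ⟨c, n + v.length, t, by rw [← ht]; simp⟩

theorem length_le_length_applySub (d : ℕ) (v : List ℕ) :
    v.length ≤ (applySub (sig d) v).length := by
  induction v with
  | nil => simp
  | cons a v ih =>
    have := List.length_pos_iff.2 (sig_ne_nil d a)
    simp only [applySub, List.length_append, List.length_cons]
    omega

/-- Left-special factors are prefixes of the fixed point. -/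
theorem exists_prefix_of_two_left_extensions {d : ℕ} (hd : 3 ≤ d) {a b : ℕ} (hab : a ≠ b)
    {u : List ℕ} (ha : Lang d (a :: u)) (hb : Lang d (b :: u)) :
    ∃ n, u <+: sigIter d n [1] := by
  induction hN : u.length using Nat.strong_induction_on generalizing a b u with
  | _ N ih =>
  subst hN
  have head_eq_one {a b c : ℕ} {u : List ℕ} (hab : a ≠ b) (ha : Lang d (a :: c :: u))
      (hb : Lang d (b :: c :: u)) : c = 1 := by
    have h1 := (List.isChain_cons_cons.1 (ha.admissible hd).2).1
    have h2 := (List.isChain_cons_cons.1 (hb.admissible hd).2).1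
    omega
  match u, ha, hb, ih with
  | [], _, _, _ => exact ⟨0, List.nil_prefix⟩
  | c :: u, ha, hb, ih =>
  obtain rfl := head_eq_one hab ha hb
  obtain ⟨p, W, hpW, hp, hW⟩ := ha.exists_desubstitution
  obtain ⟨q, W', hqW', hq, hW'⟩ := hb.exists_desubstitution
  have hpq : p ≠ q := by
    rintro rfl
    omega
  obtain ⟨v, hv, hv', hc⟩ := common_prefix_desubstitution
    (fun a ha => ((hpW.admissible hd).1 a (by simp [ha])).1)
    (fun a ha => ((hqW'.admissible hd).1 a (by simp [ha])).1) hW hW'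
  have ext {p : ℕ} {v W : List ℕ} (h : Lang d (p :: W)) (hv : v <+: W) : Lang d (p :: v) :=
    h.of_infix (List.IsPrefix.isInfix (by simpa using hv))
  have length_lt {x : ℕ} {v : List ℕ} (h : Lang d (p :: x :: v)) (h' : Lang d (q :: x :: v)) :
      (x :: v).length < (applySub (sig d) (x :: v)).length := by
    obtain rfl := head_eq_one hpq h h'
    have := length_le_length_applySub d v
    simp only [applySub, sig_one, List.length_append, List.length_cons, List.length_nil]
    omega
  cases v with
  | nil =>
    rcases hc with hc | ⟨hc, -⟩
    · simp [applySub] at hc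
    · exact ⟨0, by rw [hc]; exact List.prefix_rfl⟩
  | cons z v =>
  have hlt := length_lt (ext hpW hv) (ext hqW' hv')
  rcases hc with hc | ⟨hc, x, y, hx, hy, hvx, hvy⟩
  · obtain ⟨n, hn⟩ := ih _ (by rw [hc]; exact hlt) hpq (ext hpW hv) (ext hqW' hv') rfl
    exact ⟨n + 1, by rw [hc, sigIter_succ]; exact applySub_prefix _ hn⟩
  · have hlen := congrArg List.length hc
    rw [List.length_append] at hlen
    have finish {e m : ℕ} (he : e = 1 ∨ e = d) (h : (z :: v) ++ [e] <+: sigIter d m [1]) :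
        ∃ n, 1 :: u <+: sigIter d n [1] := by
      refine ⟨m + 1, ?_⟩
      rw [hc, sigIter_succ]
      refine List.IsPrefix.trans ?_ (applySub_prefix _ h)
      rw [applySub_append]
      rcases he with rfl | rfl
      · simp [applySub, sig_one]
      · simp [applySub, sig, show e ≠ 1 by omega]
    by_cases hxy : x = 1 ∧ y = 1
    · obtain ⟨rfl, rfl⟩ := hxy
      obtain ⟨m, hm⟩ := ih (z :: v ++ [1]).length
        (by simp only [List.length_append, List.length_cons, List.length_nil] at *; omega)
        hpq (ext hpW hvx) (ext hqW' hvy) rfl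
      exact finish (Or.inl rfl) hm
    · obtain ⟨n, hn⟩ := ih (z :: v).length (by omega) hpq (ext hpW hv) (ext hqW' hv') rfl
      obtain ⟨e, m, hm⟩ := exists_append_prefix hn
      refine finish ?_ hm
      obtain ⟨r, f, hr⟩ := (List.eq_nil_or_concat (z :: v)).resolve_left (by simp)
      have follow {g : ℕ} (h : Lang d (z :: v ++ [g])) : g = 1 ∨ g = f + 1 := by
        have : Lang d [f, g] := h.of_infix ⟨r, [], by rw [hr]; simp⟩
        exact (List.isChain_cons_cons.1 (this.admissible hd).2).1
      have hfx := follow (hpW.of_infix (hvx.isInfix.trans (List.suffix_cons _ _).isInfix))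
      have hfy := follow (hqW'.of_infix (hvy.isInfix.trans (List.suffix_cons _ _).isInfix))
      have hfe := follow ⟨m, hm.isInfix⟩
      omega

theorem finite_setOf_lang {d : ℕ} (hd : 3 ≤ d) (n : ℕ) :
    {u : List ℕ | Lang d u ∧ u.length = n}.Finite := by
  induction n with
  | zero => exact (Set.finite_singleton []).subset fun u hu => List.length_eq_zero_iff.1 hu.2
  | succ n ih =>
    refine ((Set.finite_Icc 1 d).image2 List.cons ih).subset ?_
    rintro (_ | ⟨a, u⟩) ⟨hu, hn⟩
    · simp at hn
    · exact ⟨a, (hu.admissible hd).1 a (by simp), u,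
        ⟨hu.of_infix (List.suffix_cons a u).isInfix, by simpa using hn⟩, rfl⟩

theorem ncard_setOf_lang_succ {d : ℕ} (hd : 3 ≤ d) (n : ℕ) :
    {u : List ℕ | Lang d u ∧ u.length = n + 1}.ncard =
      {u : List ℕ | Lang d u ∧ u.length = n}.ncard + (d - 1) := by
  set w := (sigIter d n [1]).take n with hw
  have hwp : w <+: sigIter d n [1] := List.take_prefix _ _
  have hwn : w.length = n := by
    rw [hw, List.length_take]
    exact min_eq_left (lt_length_sigIter_one d n).le
  have hwL : w ∈ {u : List ℕ | Lang d u ∧ u.length = n} := ⟨⟨n, hwp.isInfix⟩, hwn⟩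
  have huniq {a b : ℕ} {u : List ℕ} (hab : a ≠ b) (ha : Lang d (a :: u)) (hb : Lang d (b :: u))
      (hu : u.length = n) : u = w := by
    obtain ⟨m, hm⟩ := exists_prefix_of_two_left_extensions hd hab ha hb
    have h1 := hm.trans (sigIter_one_prefix d (le_max_left m n))
    have h2 := hwp.trans (sigIter_one_prefix d (le_max_right m n))
    exact (List.prefix_of_prefix_length_le h1 h2 (by omega)).eq_of_length (by omega)
  have hsplit : {u : List ℕ | Lang d u ∧ u.length = n + 1} =
      (fun a => a :: w) '' Set.Icc 1 d ∪
        {u | (Lang d u ∧ u.length = n + 1) ∧ u.tail ≠ w} := by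
    ext u
    constructor
    · intro hu
      by_cases h : u.tail = w
      · left
        obtain ⟨hu, hn⟩ := hu
        match u, hu, hn, h with
        | a :: u, hu, _, h => exact ⟨a, (hu.admissible hd).1 a (by simp), by simpa using h.symm⟩
      · exact Or.inr ⟨hu, h⟩
    · rintro (⟨a, ha, rfl⟩ | h)
      · refine ⟨(lang_cons_sigIter_one hd n ha.1 ha.2).of_infix ?_, by simp [hwn]⟩
        exact List.IsPrefix.isInfix (by simpa using hwp)
      · exact h.1
  have hrest : {u : List ℕ | (Lang d u ∧ u.length = n + 1) ∧ u.tail ≠ w}.ncard =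
      ({u : List ℕ | Lang d u ∧ u.length = n} \ {w}).ncard := by
    refine Set.ncard_congr (fun u _ => u.tail) ?_ ?_ ?_
    · rintro u ⟨⟨hu, hn⟩, h⟩
      exact ⟨⟨hu.of_infix u.tail_suffix.isInfix, by simp [hn]⟩, h⟩
    · rintro (_ | ⟨a, u⟩) (_ | ⟨b, v⟩) ⟨⟨hu, hn⟩, h⟩ ⟨⟨hv, hn'⟩, -⟩ huv
      · rfl
      · simp at hn
      · simp at hn'
      · obtain rfl : u = v := huv
        by_contra hne
        exact h (huniq (fun hab => hne (by rw [hab])) hu hv (by simpa using hn))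
    · rintro u ⟨⟨hu, hn⟩, h⟩
      obtain ⟨a, ha⟩ := hu.exists_cons hd
      exact ⟨a :: u, ⟨⟨ha, by simp [hn]⟩, h⟩, rfl⟩
  have hdisj : Disjoint ((fun a => a :: w) '' Set.Icc 1 d)
      {u | (Lang d u ∧ u.length = n + 1) ∧ u.tail ≠ w} := by
    rw [Set.disjoint_left]
    rintro _ ⟨a, -, rfl⟩ h
    exact h.2 rfl
  have hpos := (Set.ncard_pos (finite_setOf_lang hd n)).2 ⟨w, hwL⟩
  rw [hsplit, Set.ncard_union_eq hdisj ((Set.finite_Icc 1 d).image _)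
    ((finite_setOf_lang hd (n + 1)).subset fun u hu => hu.1), hrest,
    Set.ncard_sdiff_singleton_of_mem hwL,
    Set.ncard_image_of_injective _ (fun a b h => (List.cons.inj h).1),
    ← Finset.coe_Icc, Set.ncard_coe_finset, Nat.card_Icc]
  omega

/-- For every n ≥ 1, L(Ω) contains exactly (d−1)n + 1 words of length n. -/
theorem stmt_7 (d : ℕ) (hd : 3 ≤ d) (n : ℕ) (hn : 1 ≤ n) :
    Set.ncard {u : List ℕ | Lang d u ∧ u.length = n} = (d - 1) * n + 1 := by
  clear hn
  induction n with
  | zero =>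
    have : {u : List ℕ | Lang d u ∧ u.length = 0} = {[]} := by
      ext u
      simp only [Set.mem_ofPred_eq, List.length_eq_zero_iff, Set.mem_singleton_iff,
        and_iff_right_iff_imp]
      rintro rfl
      exact ⟨0, List.nil_infix⟩
    rw [this, Set.ncard_singleton, mul_zero]
  | succ n ih =>
    rw [ncard_setOf_lang_succ hd, ih]
    ring
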